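/- arXiv:math/0511148 — 2 statements merged into one kernel-verified Lean document; each statement's English description precedes it below -/
import Mathlib

section
/- The q-Saalschütz summation for a terminating balanced ₃φ₂: for n ∈ ℕ and complex numbers q, a, b, c with 0 < |q| < 1 such that none of the factors (c;q)_k, (q^{1−n}ab/c;q)_k for 0 ≤ k ≤ n−1 vanish, one has ∑_{k=0}^n ((a;q)_k (b;q)_k (q^{−n};q)_k / ((c;q)_k (q^{1−n}ab c^{−1};q)_k (q;q)_k)) q^k = ((c/a;q)_n (c/b;q)_n) / ((c;q)_n (c/(ab);q)_n). -/
/-- The finite `q`-shifted factorial `(a;q)_k`. -/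
noncomputable def qPoch (a q : ℂ) (k : ℕ) : ℂ := ∏ j ∈ Finset.range k, (1 - a * q ^ j)

open Finset in
/-- A sum over `i + j = n + 1` whose summand obeys a Pascal-type recurrence. -/
lemma sum_antidiagonal_succ_of_pascal {R : Type*} [AddCommMonoid R] (F α β : ℕ → ℕ → R) (n : ℕ)
    (h0 : F 0 (n + 1) = α 0 n) (h1 : F (n + 1) 0 = β n 0)
    (h : ∀ i j, i + j + 1 = n → F (i + 1) (j + 1) = α (i + 1) j + β i (j + 1)) :
    ∑ p ∈ antidiagonal (n + 1), F p.1 p.2 =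
      ∑ p ∈ antidiagonal n, (α p.1 p.2 + β p.1 p.2) := by
  cases n with
  | zero => simp [Nat.antidiagonal_succ, h0, h1]
  | succ m =>
    have hs : ∑ p ∈ antidiagonal m, F (p.1 + 1) (p.2 + 1) =
        ∑ p ∈ antidiagonal m, (α (p.1 + 1) p.2 + β p.1 (p.2 + 1)) :=
      sum_congr rfl fun p hp => h _ _ (by rw [mem_antidiagonal.mp hp])
    rw [Nat.sum_antidiagonal_succ, Nat.sum_antidiagonal_succ', sum_add_distrib,
      Nat.sum_antidiagonal_succ (f := fun p => α p.1 p.2),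
      Nat.sum_antidiagonal_succ' (f := fun p => β p.1 p.2)]
    simp only [hs, h0, h1, sum_add_distrib]
    abel

lemma qPoch_zero (a q : ℂ) : qPoch a q 0 = 1 := by simp [qPoch]

lemma qPoch_succ (a q : ℂ) (k : ℕ) : qPoch a q (k + 1) = qPoch a q k * (1 - a * q ^ k) := by
  simp [qPoch, Finset.prod_range_succ]

lemma qPoch_add (a q : ℂ) (i j : ℕ) :
    qPoch a q (i + j) = qPoch a q i * qPoch (a * q ^ i) q j := by
  simp [qPoch, Finset.prod_range_add, pow_add, mul_assoc]

lemma qPoch_succ' (a q : ℂ) (k : ℕ) : qPoch a q (k + 1) = (1 - a) * qPoch (a * q) q k := by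
  rw [add_comm, qPoch_add]
  simp [qPoch]

lemma qPoch_ne_zero {a q : ℂ} {k : ℕ} (h : ∀ j < k, 1 - a * q ^ j ≠ 0) : qPoch a q k ≠ 0 :=
  Finset.prod_ne_zero_iff.mpr fun j hj => h j (Finset.mem_range.mp hj)

/-- Reflection of a `q`-shifted factorial; the constant does not depend on `x`. -/
lemma exists_qPoch_reflection {q : ℂ} (hq : q ≠ 0) (i j : ℕ) :
    ∃ K : ℂ, K ≠ 0 ∧ ∀ x : ℂ, x ≠ 0 →
      qPoch x q (i + j) = qPoch x q j * qPoch (q ^ (1 - ((i + j : ℕ) : ℤ)) / x) q i * x ^ i * K := by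
  induction i generalizing j with
  | zero => exact ⟨1, one_ne_zero, fun x _ => by simp [qPoch_zero]⟩
  | succ i ih =>
    obtain ⟨K, hK, h⟩ := ih (j + 1)
    refine ⟨-q ^ j * K, mul_ne_zero (neg_ne_zero.mpr (pow_ne_zero _ hq)) hK, fun x hx => ?_⟩
    have e : i + 1 + j = i + (j + 1) := by ring
    rw [e, h x hx, qPoch_succ x, qPoch_succ _ q i]
    have hz : q ^ (1 - ((i + (j + 1) : ℕ) : ℤ)) * q ^ i * q ^ j = 1 := by
      rw [← zpow_natCast q i, ← zpow_natCast q j, ← zpow_add₀ hq, ← zpow_add₀ hq]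
      convert zpow_zero q using 2
      push_cast
      ring
    have hf : (1 - x * q ^ j) =
        (1 - q ^ (1 - ((i + (j + 1) : ℕ) : ℤ)) / x * q ^ i) * x * (-q ^ j) := by
      field_simp
      linear_combination (-1 : ℂ) * hz
    rw [hf]
    ring

/-- The `q`-Saalschütz sum in division-free parameters, with `c = a * b * e`. -/
lemma sum_antidiagonal_qPoch {q : ℂ} (hq : ∀ m, qPoch q q m ≠ 0) (a b e : ℂ) (n : ℕ) :
    ∑ p ∈ Finset.HasAntidiagonal.antidiagonal n,
        qPoch a q p.1 * qPoch b q p.1 * qPoch (a * b * e * q ^ p.1) q p.2 * qPoch e q p.2 *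
          e ^ p.1 / (qPoch q q p.1 * qPoch q q p.2) =
      qPoch (b * e) q n * qPoch (a * e) q n / qPoch q q n := by
  have hf : ∀ m, 1 - q * q ^ m ≠ 0 := fun m h => hq (m + 1) (by rw [qPoch_succ, h, mul_zero])
  induction n with
  | zero => simp [qPoch_zero]
  | succ n ih =>
    set f : ℕ → ℕ → ℂ := fun i j => qPoch a q i * qPoch b q i * qPoch (a * b * e * q ^ i) q j *
      qPoch e q j * e ^ i / (qPoch q q i * qPoch q q j) with hfdef
    have key := sum_antidiagonal_succ_of_pascal
      (fun i j => (1 - q * q ^ n) * f i j)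
      (fun i j => (1 - e * q ^ j) * (1 - a * b * e * q ^ (n + i)) * f i j)
      (fun i j => q ^ j * e * (1 - a * q ^ i) * (1 - b * q ^ i) * f i j) n
      (by
        have := hq n
        have := hf n
        simp only [hfdef, qPoch_succ, qPoch_zero]
        field_simp
        ring)
      (by
        have := hq n
        have := hf n
        simp only [hfdef, qPoch_succ, qPoch_zero]
        field_simp
        ring)
      (by
        rintro i j rfl
        have := hq i
        have := hf i
        have := hq j
        have := hf j
        simp only [hfdef]
        rw [qPoch_succ' (a * b * e * q ^ i) q j, qPoch_succ (a * b * e * q ^ (i + 1)) q j]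
        rw [show a * b * e * q ^ i * q = a * b * e * q ^ (i + 1) by ring]
        simp only [qPoch_succ]
        field_simp
        ring)
    have hr : ∑ p ∈ Finset.HasAntidiagonal.antidiagonal n,
        ((1 - e * q ^ p.2) * (1 - a * b * e * q ^ (n + p.1)) * f p.1 p.2 +
          q ^ p.2 * e * (1 - a * q ^ p.1) * (1 - b * q ^ p.1) * f p.1 p.2) =
        (1 - b * e * q ^ n) * (1 - a * e * q ^ n) * ∑ p ∈ Finset.HasAntidiagonal.antidiagonal n, f p.1 p.2 := by
      rw [Finset.mul_sum]
      refine Finset.sum_congr rfl fun p hp => ?_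
      rw [← Finset.HasAntidiagonal.mem_antidiagonal.mp hp]
      ring
    rw [hr, ih, ← Finset.mul_sum] at key
    have := hq n
    have := hf n
    rw [← mul_right_inj' (hf n), key]
    simp only [qPoch_succ]
    generalize 1 - q * q ^ n = v at *
    field_simp

/-- The `q`-Saalschütz summation for a terminating balanced `₃φ₂`:
`∑_{k=0}^n ((a;q)_k (b;q)_k (q^{−n};q)_k / ((c;q)_k (q^{1−n}ab/c;q)_k (q;q)_k)) q^k
  = ((c/a;q)_n (c/b;q)_n) / ((c;q)_n (c/(ab);q)_n)`,
for `0 < ‖q‖ < 1`, `a, b, c` nonzero, where none of the factors of `(c;q)_n` and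
`(q^{1−n}ab/c;q)_n` vanish. -/
theorem q_saalschutz (n : ℕ) (q a b c : ℂ) (hq0 : 0 < ‖q‖) (hq1 : ‖q‖ < 1)
    (ha : a ≠ 0) (hb : b ≠ 0) (hc0 : c ≠ 0)
    (hc : ∀ j : ℕ, j < n → 1 - c * q ^ j ≠ 0)
    (hd : ∀ j : ℕ, j < n → 1 - q ^ ((1 : ℤ) - n) * a * b / c * q ^ j ≠ 0) :
    ∑ k ∈ Finset.range (n + 1),
        qPoch a q k * qPoch b q k * qPoch (q ^ (-(n : ℤ))) q k /
          (qPoch c q k * qPoch (q ^ ((1 : ℤ) - n) * a * b / c) q k * qPoch q q k) * q ^ k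
      = qPoch (c / a) q n * qPoch (c / b) q n /
          (qPoch c q n * qPoch (c / (a * b)) q n) := by
  have hq : q ≠ 0 := norm_pos_iff.mp hq0
  have hqq : ∀ m, qPoch q q m ≠ 0 := fun m => qPoch_ne_zero fun j _ h => by
    have h1 : q ^ (j + 1) = 1 := by linear_combination -h
    have h2 : ‖q‖ ^ (j + 1) = 1 := by rw [← norm_pow, h1, norm_one]
    exact (pow_lt_one₀ hq0.le hq1 j.succ_ne_zero).ne h2
  obtain ⟨e, he⟩ : ∃ e, e = c / (a * b) := ⟨_, rfl⟩
  have he0 : e ≠ 0 := he ▸ div_ne_zero hc0 (mul_ne_zero ha hb)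
  have hce : c = a * b * e := by rw [he]; field_simp
  have hd' : q ^ ((1 : ℤ) - n) * a * b / c = q ^ ((1 : ℤ) - n) / e := by
    rw [hce]; field_simp
  have hqn : q ^ (-(n : ℤ)) = q ^ ((1 : ℤ) - n) / q := by
    rw [zpow_sub₀ hq, zpow_neg]; field_simp
  have hcn : qPoch c q n ≠ 0 := qPoch_ne_zero hc
  have hdn : ∀ k ≤ n, qPoch (q ^ ((1 : ℤ) - n) / e) q k ≠ 0 := fun k hk =>
    qPoch_ne_zero fun j hj => hd' ▸ hd j (hj.trans_le hk)
  have hen : qPoch e q n ≠ 0 := by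
    obtain ⟨K, hK, h⟩ := exists_qPoch_reflection hq n 0
    rw [← add_zero n, h e he0, qPoch_zero, add_zero]
    exact mul_ne_zero (mul_ne_zero (mul_ne_zero one_ne_zero (hdn n le_rfl)) (pow_ne_zero _ he0)) hK
  have main := sum_antidiagonal_qPoch hqq a b e n
  rw [hd', hqn, ← he, show c / a = b * e by rw [hce]; field_simp,
    show c / b = a * e by rw [hce]; field_simp]
  have hsum := Finset.Nat.sum_antidiagonal_eq_sum_range_succ (fun k _ =>
    qPoch a q k * qPoch b q k * qPoch (q ^ ((1 : ℤ) - n) / q) q k /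
      (qPoch c q k * qPoch (q ^ ((1 : ℤ) - n) / e) q k * qPoch q q k) * q ^ k) n
  rw [← Nat.succ_eq_add_one, ← hsum]
  have hscale : qPoch (b * e) q n * qPoch (a * e) q n / (qPoch c q n * qPoch e q n) =
      qPoch q q n / (qPoch c q n * qPoch e q n) *
        (qPoch (b * e) q n * qPoch (a * e) q n / qPoch q q n) := by
    have := hqq n
    field_simp
  rw [hscale, ← main, Finset.mul_sum]
  refine Finset.sum_congr rfl fun p hp => ?_
  obtain ⟨i, j⟩ := p
  obtain rfl : i + j = n := Finset.HasAntidiagonal.mem_antidiagonal.mp hp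
  obtain ⟨K, hK, h⟩ := exists_qPoch_reflection hq i j
  have hDi := hdn i (Nat.le_add_right i j)
  have hqi := hqq i
  have hqj := hqq j
  have hc' := qPoch_add c q i j
  rw [hc'] at hcn
  have hci := left_ne_zero_of_mul hcn
  have hcj := right_ne_zero_of_mul hcn
  have hE := h e he0
  rw [hE] at hen
  have hej : qPoch e q j ≠ 0 := fun h0 => hen (by rw [h0]; ring)
  simp only [← hce]
  rw [hE, hc', h q hq]
  generalize qPoch (c * q ^ i) q j = C at *
  field_simp
end

section
/- The first Rogers–Ramanujan identity: for a complex number q with |q| < 1, ∑_{k=0}^∞ q^{k²} / (q;q)_k = 1 / ((q;q⁵)_∞ (q⁴;q⁵)_∞). -/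
/-- The infinite `q`-shifted factorial `(a;q)_∞` (here used as `(a;p)_∞`). -/
noncomputable def qPochInf (a q : ℂ) : ℂ := ∏' j : ℕ, (1 - a * q ^ j)

open Finset Filter Topology

/-- The reciprocal `1 / (q;q)_m`. -/
noncomputable def qPochRecip (q : ℂ) (m : ℕ) : ℂ := (qPoch q q m)⁻¹

/-- The bilateral theta coefficients with the indices `j` and `-j` collected:
`1` for `j = 0`, and `(-1)^j q^{j(j-1)/2} (z^j + y^j)` for `j > 0`, where `z * y = q`. -/
noncomputable def thetaCoeff (z y q : ℂ) (j : ℕ) : ℂ :=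
  if j = 0 then 1 else (-1) ^ j * q ^ (j.choose 2) * (z ^ j + y ^ j)

lemma one_sub_pow_succ_ne_zero {q : ℂ} (hq : ‖q‖ < 1) (m : ℕ) : 1 - q ^ (m + 1) ≠ 0 := by
  intro h
  have h1 : ‖q ^ (m + 1)‖ < 1 := by
    rw [norm_pow]
    exact pow_lt_one₀ (norm_nonneg q) hq (Nat.succ_ne_zero m)
  rw [← sub_eq_zero.mp h] at h1
  simp at h1

lemma qPochRecip_zero (q : ℂ) : qPochRecip q 0 = 1 := by
  simp [qPochRecip, qPoch]

lemma one_sub_pow_mul_qPochRecip_succ {q : ℂ} (hq : ‖q‖ < 1) (m : ℕ) :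
    (1 - q ^ (m + 1)) * qPochRecip q (m + 1) = qPochRecip q m := by
  have h := one_sub_pow_succ_ne_zero hq m
  have h2 : qPoch q q (m + 1) = qPoch q q m * (1 - q ^ (m + 1)) := by
    rw [qPoch, prod_range_succ, qPoch, pow_succ' q m]
  rw [qPochRecip, h2, mul_inv, qPochRecip]
  field_simp

lemma one_sub_pow_mul_sum_antidiagonal_succ {q : ℂ} (hq : ‖q‖ < 1) (N : ℕ) (f : ℕ → ℕ → ℂ) :
    (1 - q ^ (N + 1)) *
        ∑ p ∈ antidiagonal (N + 1), f p.1 p.2 * qPochRecip q p.1 * qPochRecip q p.2 =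
      ∑ p ∈ antidiagonal N, f p.1 (p.2 + 1) * qPochRecip q p.1 * qPochRecip q p.2 +
      ∑ p ∈ antidiagonal N, q ^ p.2 * f (p.1 + 1) p.2 * qPochRecip q p.1 * qPochRecip q p.2 := by
  have h : (1 - q ^ (N + 1)) *
        ∑ p ∈ antidiagonal (N + 1), f p.1 p.2 * qPochRecip q p.1 * qPochRecip q p.2 =
      ∑ p ∈ antidiagonal (N + 1),
        f p.1 p.2 * qPochRecip q p.1 * ((1 - q ^ p.2) * qPochRecip q p.2) +
      ∑ p ∈ antidiagonal (N + 1),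
        q ^ p.2 * f p.1 p.2 * ((1 - q ^ p.1) * qPochRecip q p.1) * qPochRecip q p.2 := by
    rw [mul_sum, ← sum_add_distrib]
    refine sum_congr rfl fun p hp => ?_
    rw [← mem_antidiagonal.mp hp, pow_add]
    ring
  rw [h, Nat.sum_antidiagonal_succ', Nat.sum_antidiagonal_succ]
  simp [one_sub_pow_mul_qPochRecip_succ hq]

/-- A form of the `q`-Chu–Vandermonde summation. -/
lemma sum_antidiagonal_qVandermonde {q : ℂ} (hq : ‖q‖ < 1) (N m : ℕ) :
    ∑ p ∈ antidiagonal N,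
        q ^ (p.1 * (p.1 + m)) * qPochRecip q (p.1 + m) * qPochRecip q p.1 * qPochRecip q p.2 =
      qPochRecip q N * qPochRecip q (N + m) := by
  induction N generalizing m with
  | zero => simp [qPochRecip_zero]
  | succ N ih =>
    apply mul_left_cancel₀ (one_sub_pow_succ_ne_zero hq N)
    rw [one_sub_pow_mul_sum_antidiagonal_succ hq N
      (fun a _ => q ^ (a * (a + m)) * qPochRecip q (a + m)), ih m]
    have h : ∑ p ∈ antidiagonal N, q ^ p.2 * (q ^ ((p.1 + 1) * (p.1 + 1 + m)) *
          qPochRecip q (p.1 + 1 + m)) * qPochRecip q p.1 * qPochRecip q p.2 =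
        q ^ (N + m + 1) * (qPochRecip q N * qPochRecip q (N + (m + 1))) := by
      rw [← ih (m + 1), mul_sum]
      refine sum_congr rfl fun p hp => ?_
      rw [← mem_antidiagonal.mp hp, show p.1 + 1 + m = p.1 + (m + 1) by ring]
      ring
    rw [h, ← mul_assoc (1 - q ^ (N + 1)), one_sub_pow_mul_qPochRecip_succ hq,
      ← one_sub_pow_mul_qPochRecip_succ hq (N + m), show N + 1 + m = N + m + 1 by ring,
      show N + (m + 1) = N + m + 1 by ring]
    ring

/-- The homogeneous finite `q`-binomial theorem. -/
lemma sum_antidiagonal_qBinomial {q : ℂ} (hq : ‖q‖ < 1) (x u : ℂ) (N : ℕ) :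
    ∑ p ∈ antidiagonal N,
        (-x) ^ p.1 * u ^ p.2 * q ^ (p.1.choose 2) * qPochRecip q p.1 * qPochRecip q p.2 =
      (∏ j ∈ range N, (u - x * q ^ j)) * qPochRecip q N := by
  induction N with
  | zero => simp [qPochRecip_zero]
  | succ N ih =>
    apply mul_left_cancel₀ (one_sub_pow_succ_ne_zero hq N)
    rw [one_sub_pow_mul_sum_antidiagonal_succ hq N
      (fun a b => (-x) ^ a * u ^ b * q ^ (a.choose 2)), mul_left_comm,
      one_sub_pow_mul_qPochRecip_succ hq, prod_range_succ, mul_right_comm, ← ih, sum_mul,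
      ← sum_add_distrib]
    refine sum_congr rfl fun p hp => ?_
    rw [← mem_antidiagonal.mp hp, Nat.choose_succ_succ' p.1 1, Nat.choose_one_right]
    ring

lemma sum_antidiagonal_two_mul {M : Type*} [AddCommMonoid M] (n : ℕ) (g : ℕ → ℕ → M) :
    ∑ p ∈ antidiagonal (2 * n), g p.1 p.2 =
      g n n + ∑ j ∈ range n, (g (n + (j + 1)) (n - (j + 1)) + g (n - (j + 1)) (n + (j + 1))) := by
  induction n generalizing g with
  | zero => simp
  | succ n ih =>
    rw [show 2 * (n + 1) = 2 * n + 1 + 1 by ring, Nat.sum_antidiagonal_succ,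
      Nat.sum_antidiagonal_succ', ih fun a b => g (a + 1) (b + 1), sum_range_succ]
    have h : ∀ j ∈ range n,
        g (n + (j + 1) + 1) (n - (j + 1) + 1) + g (n - (j + 1) + 1) (n + (j + 1) + 1) =
        g (n + 1 + (j + 1)) (n + 1 - (j + 1)) + g (n + 1 - (j + 1)) (n + 1 + (j + 1)) := by
      intro j hj
      have := mem_range.mp hj
      rw [show n + (j + 1) + 1 = n + 1 + (j + 1) by ring,
        show n - (j + 1) + 1 = n + 1 - (j + 1) by omega]
    rw [sum_congr rfl h, Nat.sub_self, show 2 * n + 1 + 1 = n + 1 + (n + 1) by ring]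
    abel

lemma prod_range_two_mul_sub_eq {z y q : ℂ} (hzy : z * y = q) (n : ℕ) :
    ∏ j ∈ range (2 * n), (q ^ n - z * q ^ j) =
      (-z) ^ n * q ^ (n.choose 2 + n * n) * (qPoch z q n * qPoch y q n) := by
  rw [two_mul, prod_range_add]
  have h1 : ∏ j ∈ range n, (q ^ n - z * q ^ (n + j)) = q ^ (n * n) * qPoch z q n := by
    have h : ∀ j ∈ range n, q ^ n - z * q ^ (n + j) = q ^ n * (1 - z * q ^ j) := fun j _ => by
      ring
    rw [prod_congr rfl h, prod_mul_distrib, prod_const, card_range, pow_mul, qPoch]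
  have h2 : ∏ j ∈ range n, (q ^ n - z * q ^ j) =
      (-z) ^ n * q ^ (n.choose 2) * qPoch y q n := by
    have h : ∀ j ∈ range n, q ^ n - z * q ^ j = -z * q ^ j * (1 - y * q ^ (n - 1 - j)) := by
      intro j hj
      have hj := mem_range.mp hj
      have : q ^ n = q ^ j * q ^ (n - 1 - j) * (z * y) := by
        rw [hzy, ← pow_add, ← pow_succ]
        congr 1
        omega
      rw [this]
      ring
    rw [prod_congr rfl h, prod_mul_distrib, prod_mul_distrib, prod_const, card_range,
      prod_pow_eq_pow_sum, sum_range_id, ← Nat.choose_two_right, qPoch,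
      prod_range_reflect (fun j => 1 - y * q ^ j)]
  rw [h1, h2]
  ring

lemma choose_two_add (a b : ℕ) : (a + b).choose 2 = a.choose 2 + b.choose 2 + a * b := by
  induction b with
  | zero => simp
  | succ b ih =>
    rw [← add_assoc, Nat.choose_succ_succ' (a + b) 1, Nat.choose_succ_succ' b 1, ih,
      Nat.choose_one_right, Nat.choose_one_right]
    ring

lemma choose_two_mul_two_add (k : ℕ) : k.choose 2 * 2 + k = k * k := by
  induction k with
  | zero => simp
  | succ k ih =>
    rw [Nat.choose_succ_succ' k 1, Nat.choose_one_right]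
    nlinarith

/-- The finite form of Jacobi's triple product identity. -/
lemma sum_thetaCoeff_mul_qPochRecip {z y q : ℂ} (hq : ‖q‖ < 1) (hq0 : q ≠ 0) (hzy : z * y = q)
    (n : ℕ) :
    ∑ j ∈ range (n + 1), thetaCoeff z y q j * (qPochRecip q (n - j) * qPochRecip q (n + j)) =
      qPoch z q n * qPoch y q n * qPochRecip q (2 * n) := by
  have hz : z ≠ 0 := by
    rintro rfl
    exact hq0 (by simpa using hzy.symm)
  have hc : (-z) ^ n * q ^ (n.choose 2 + n * n) ≠ 0 := by
    simp [hz, hq0]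
  apply mul_left_cancel₀ hc
  rw [← mul_assoc, ← prod_range_two_mul_sub_eq hzy, ← sum_antidiagonal_qBinomial hq,
    sum_antidiagonal_two_mul n fun a b =>
      (-z) ^ a * (q ^ n) ^ b * q ^ (a.choose 2) * qPochRecip q a * qPochRecip q b,
    sum_range_succ', mul_add, mul_sum, add_comm]
  congr 1
  · simp only [thetaCoeff, if_true, Nat.sub_zero, add_zero]
    ring
  · refine sum_congr rfl fun j hj => ?_
    obtain ⟨m, rfl⟩ := Nat.exists_eq_add_of_lt (mem_range.mp hj)
    rw [show j + m + 1 - (j + 1) = m by omega]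
    simp only [thetaCoeff, Nat.succ_ne_zero, if_false]
    set k := j + 1 with hk
    have hkm : j + m + 1 = k + m := by omega
    rw [hkm]
    have e1 : (-z) ^ (k + m + k) * (q ^ (k + m)) ^ m * q ^ ((k + m + k).choose 2) =
        (-z) ^ (k + m) * q ^ ((k + m).choose 2 + (k + m) * (k + m)) *
          ((-1) ^ k * q ^ (k.choose 2) * z ^ k) := by
      rw [choose_two_add (k + m) k, neg_pow z (k + m + k), neg_pow z (k + m)]
      ring
    have e2 : (-z) ^ m * (q ^ (k + m)) ^ (k + m + k) * q ^ (m.choose 2) =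
        (-z) ^ (k + m) * q ^ ((k + m).choose 2 + (k + m) * (k + m)) *
          ((-1) ^ k * q ^ (k.choose 2) * y ^ k) := by
      have h2 := choose_two_mul_two_add k
      have h4 : (-z) ^ (k + m) * q ^ ((k + m).choose 2 + (k + m) * (k + m)) *
          ((-1) ^ k * q ^ (k.choose 2) * y ^ k) =
          (-z) ^ m * (z * y) ^ k * q ^ ((k + m).choose 2 + (k + m) * (k + m) + k.choose 2) := by
        have : (-1 : ℂ) ^ k * (-1) ^ k = 1 := by rw [← mul_pow]; simp
        rw [pow_add (-z), neg_pow z k, mul_pow z y]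
        linear_combination (z ^ k * (-z) ^ m * q ^ ((k + m).choose 2 + (k + m) * (k + m)) *
          (q ^ (k.choose 2) * y ^ k)) * this
      rw [h4, hzy, mul_assoc, mul_assoc, ← pow_mul, ← pow_add, ← pow_add, choose_two_add k m]
      congr 2
      nlinarith
    rw [e1, e2]
    ring

/-- Bailey's lemma with `a = 1` and both parameters sent to infinity. -/
lemma bailey_sum {q : ℂ} (hq : ‖q‖ < 1) {α β : ℕ → ℂ}
    (h : ∀ n, ∑ j ∈ range (n + 1), α j * (qPochRecip q (n - j) * qPochRecip q (n + j)) = β n)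
    (n : ℕ) :
    ∑ j ∈ range (n + 1), q ^ (j ^ 2) * α j * (qPochRecip q (n - j) * qPochRecip q (n + j)) =
      ∑ k ∈ range (n + 1), q ^ (k ^ 2) * β k * qPochRecip q (n - k) := by
  simp_rw [← h, mul_sum, sum_mul]
  rw [sum_comm' (t' := range (n + 1)) (s' := fun j => Ico j (n + 1))
    (by intro k j; simp only [mem_range, mem_Ico]; omega)]
  refine sum_congr rfl fun j hj => ?_
  obtain ⟨N, rfl⟩ := Nat.exists_eq_add_of_le (Nat.lt_succ_iff.mp (mem_range.mp hj))
  have hV := sum_antidiagonal_qVandermonde hq N (2 * j)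
  rw [Nat.sum_antidiagonal_eq_sum_range_succ fun a b =>
    q ^ (a * (a + 2 * j)) * qPochRecip q (a + 2 * j) * qPochRecip q a * qPochRecip q b] at hV
  rw [sum_Ico_eq_sum_range, show j + N - j = N by omega, show j + N + 1 - j = N + 1 by omega,
    show j + N + j = N + 2 * j by ring, ← hV, mul_sum]
  refine sum_congr rfl fun i _ => ?_
  rw [show j + N - (j + i) = N - i by omega, show j + i - j = i by omega,
    show j + i + j = i + 2 * j by ring]
  ring

/-- A finite form of the first Rogers–Ramanujan identity. -/
lemma sum_qPochRecip_eq_sum_thetaCoeff {q : ℂ} (hq : ‖q‖ < 1) (hq0 : q ≠ 0) (n : ℕ) :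
    ∑ k ∈ range (n + 1), q ^ (k ^ 2) * qPochRecip q k * qPochRecip q (n - k) =
      ∑ j ∈ range (n + 1), q ^ (j ^ 2) * (q ^ (j ^ 2) * thetaCoeff 1 q q j) *
        (qPochRecip q (n - j) * qPochRecip q (n + j)) := by
  have h0 : ∀ n, ∑ j ∈ range (n + 1), thetaCoeff 1 q q j *
      (qPochRecip q (n - j) * qPochRecip q (n + j)) = if n = 0 then 1 else 0 := by
    intro n
    rw [sum_thetaCoeff_mul_qPochRecip hq hq0 (one_mul q)]
    cases n with
    | zero => simp [qPoch, qPochRecip]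
    | succ n => simp [qPoch, prod_range_succ']
  refine (bailey_sum hq (fun m => ?_) n).symm
  rw [bailey_sum hq h0]
  simp

lemma qPoch_multipliable (a : ℂ) {q : ℂ} (hq : ‖q‖ < 1) :
    Multipliable fun j : ℕ => 1 - a * q ^ j := by
  have : Summable fun j : ℕ => ‖-(a * q ^ j)‖ := by
    simp only [norm_neg, norm_mul, norm_pow]
    exact (summable_geometric_of_lt_one (norm_nonneg q) hq).mul_left _
  simpa [sub_eq_add_neg] using multipliable_one_add_of_summable this

lemma tendsto_qPoch (a : ℂ) {q : ℂ} (hq : ‖q‖ < 1) :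
    Tendsto (qPoch a q) atTop (𝓝 (qPochInf a q)) :=
  (qPoch_multipliable a hq).hasProd.tendsto_prod_nat

lemma qPochInf_ne_zero {a q : ℂ} (hq : ‖q‖ < 1) (ha : ‖a‖ < 1) : qPochInf a q ≠ 0 := by
  have : Summable fun j : ℕ => ‖-(a * q ^ j)‖ := by
    simp only [norm_neg, norm_mul, norm_pow]
    exact (summable_geometric_of_lt_one (norm_nonneg q) hq).mul_left _
  have h := tprod_one_add_ne_zero_of_summable (f := fun j : ℕ => -(a * q ^ j)) (fun j hj => ?_) this
  · simpa [qPochInf, sub_eq_add_neg] using h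
  · have h1 : ‖a * q ^ j‖ < 1 := by
      rw [norm_mul, norm_pow]
      exact mul_lt_one_of_nonneg_of_lt_one_left (norm_nonneg a) ha
        (pow_le_one₀ (norm_nonneg q) hq.le)
    rw [show a * q ^ j = 1 by linear_combination -hj] at h1
    simp at h1

lemma tendsto_qPochRecip {q : ℂ} (hq : ‖q‖ < 1) :
    Tendsto (qPochRecip q) atTop (𝓝 (qPochInf q q)⁻¹) :=
  (tendsto_qPoch q hq).inv₀ (qPochInf_ne_zero hq hq)

lemma exists_norm_qPochRecip_le {q : ℂ} (hq : ‖q‖ < 1) : ∃ C, ∀ m, ‖qPochRecip q m‖ ≤ C := by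
  obtain ⟨C, hC⟩ := (Metric.isBounded_range_of_tendsto _ (tendsto_qPochRecip hq)).exists_norm_le
  exact ⟨C, fun m => hC _ ⟨m, rfl⟩⟩

/-- Tannery's theorem for truncated sums with bounded weights. -/
lemma tendsto_sum_range_succ_mul {g : ℕ → ℂ} {E : ℕ → ℕ → ℂ} {L : ℂ} {C : ℝ}
    (hg : Summable fun k => ‖g k‖) (hE : ∀ n k, ‖E n k‖ ≤ C)
    (hL : ∀ k, Tendsto (fun n => E n k) atTop (𝓝 L)) :
    Tendsto (fun n => ∑ k ∈ range (n + 1), g k * E n k) atTop (𝓝 ((∑' k, g k) * L)) := by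
  rw [← tsum_mul_right]
  have h : ∀ n, ∑ k ∈ range (n + 1), g k * E n k =
      ∑' k, if k ∈ range (n + 1) then g k * E n k else 0 := by
    intro n
    rw [tsum_eq_sum (s := range (n + 1)) fun k hk => if_neg hk]
    exact sum_congr rfl fun k hk => (if_pos hk).symm
  simp_rw [h]
  refine tendsto_tsum_of_dominated_convergence (hg.mul_right C) (fun k => ?_)
    (Eventually.of_forall fun n k => ?_)
  · refine ((hL k).const_mul (g k)).congr' ?_
    filter_upwards [eventually_ge_atTop k] with n hn
    rw [if_pos (mem_range.mpr (Nat.lt_succ_of_le hn))]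
  · have hb : ‖g k * E n k‖ ≤ ‖g k‖ * C := by
      rw [norm_mul]
      exact mul_le_mul_of_nonneg_left (hE n k) (norm_nonneg _)
    split_ifs
    · exact hb
    · simpa using (norm_nonneg _).trans hb

lemma qPoch_five_mul (q : ℂ) (n : ℕ) :
    qPoch q q (5 * n) = qPoch q (q ^ 5) n * qPoch (q ^ 2) (q ^ 5) n * qPoch (q ^ 3) (q ^ 5) n *
      qPoch (q ^ 4) (q ^ 5) n * qPoch (q ^ 5) (q ^ 5) n := by
  induction n with
  | zero => simp [qPoch]
  | succ n ih =>
    simp only [qPoch, show 5 * (n + 1) = 5 * n + 1 + 1 + 1 + 1 + 1 by ring,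
      prod_range_succ] at ih ⊢
    rw [ih]
    ring

lemma qPochInf_five_dissection {q : ℂ} (hq : ‖q‖ < 1) (hq5 : ‖q ^ 5‖ < 1) :
    qPochInf q q = qPochInf q (q ^ 5) * qPochInf (q ^ 2) (q ^ 5) * qPochInf (q ^ 3) (q ^ 5) *
      qPochInf (q ^ 4) (q ^ 5) * qPochInf (q ^ 5) (q ^ 5) := by
  have h : Tendsto (fun n : ℕ => 5 * n) atTop atTop :=
    tendsto_id.const_mul_atTop' (by norm_num)
  refine tendsto_nhds_unique ((tendsto_qPoch q hq).comp h) ?_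
  simp only [Function.comp_def, qPoch_five_mul]
  exact ((((tendsto_qPoch _ hq5).mul (tendsto_qPoch _ hq5)).mul (tendsto_qPoch _ hq5)).mul
    (tendsto_qPoch _ hq5)).mul (tendsto_qPoch _ hq5)

lemma tendsto_sum_mul_qPochRecip_mul {q : ℂ} (hq : ‖q‖ < 1) {g : ℕ → ℂ}
    (hg : Summable fun k => ‖g k‖) :
    Tendsto (fun n => ∑ j ∈ range (n + 1), g j * (qPochRecip q (n - j) * qPochRecip q (n + j)))
      atTop (𝓝 ((∑' k, g k) * ((qPochInf q q)⁻¹ * (qPochInf q q)⁻¹))) := by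
  obtain ⟨C, hC⟩ := exists_norm_qPochRecip_le hq
  refine tendsto_sum_range_succ_mul (C := C * C) hg (fun n k => ?_) fun k => ?_
  · rw [norm_mul]
    exact mul_le_mul (hC _) (hC _) (norm_nonneg _) ((norm_nonneg _).trans (hC 0))
  · exact ((tendsto_qPochRecip hq).comp (tendsto_sub_atTop_nat k)).mul
      ((tendsto_qPochRecip hq).comp (tendsto_add_atTop_nat k))

/-- Jacobi's triple product identity. -/
lemma tsum_thetaCoeff {z y q : ℂ} (hq : ‖q‖ < 1) (hq0 : q ≠ 0) (hzy : z * y = q)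
    (hs : Summable fun j => ‖thetaCoeff z y q j‖) :
    ∑' j, thetaCoeff z y q j = qPochInf z q * qPochInf y q * qPochInf q q := by
  have h1 := tendsto_sum_mul_qPochRecip_mul hq hs
  simp_rw [sum_thetaCoeff_mul_qPochRecip hq hq0 hzy] at h1
  have h2 : Tendsto (fun n : ℕ => 2 * n) atTop atTop :=
    tendsto_id.const_mul_atTop' (by norm_num)
  have h3 := tendsto_nhds_unique h1 (((tendsto_qPoch z hq).mul (tendsto_qPoch y hq)).mul
    ((tendsto_qPochRecip hq).comp h2))
  have h4 := qPochInf_ne_zero hq hq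
  field_simp at h3
  linear_combination h3

lemma pow_sq_mul_thetaCoeff (q : ℂ) (j : ℕ) :
    q ^ (j ^ 2) * (q ^ (j ^ 2) * thetaCoeff 1 q q j) = thetaCoeff (q ^ 2) (q ^ 3) (q ^ 5) j := by
  rcases j with - | j
  · simp [thetaCoeff]
  · simp only [thetaCoeff, Nat.succ_ne_zero, if_false]
    set k := j + 1
    have hk : k ^ 2 = k.choose 2 * 2 + k := by rw [choose_two_mul_two_add, sq]
    rw [hk]
    ring

lemma summable_norm_thetaCoeff_five {q : ℂ} (hq : ‖q‖ < 1) :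
    Summable fun j => ‖thetaCoeff (q ^ 2) (q ^ 3) (q ^ 5) j‖ := by
  refine Summable.of_nonneg_of_le (fun _ => norm_nonneg _) (fun j => ?_)
    ((summable_geometric_of_lt_one (norm_nonneg q) hq).mul_left 2)
  rw [thetaCoeff]
  split_ifs with h
  · simp [h]
  · have h1 : ‖(q ^ 5) ^ (j.choose 2)‖ ≤ 1 := by
      rw [norm_pow, norm_pow]
      exact pow_le_one₀ (by positivity) (pow_le_one₀ (norm_nonneg q) hq.le)
    have h2 : ∀ m, 1 ≤ m → ‖(q ^ m) ^ j‖ ≤ ‖q‖ ^ j := by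
      intro m hm
      rw [← pow_mul, norm_pow]
      exact pow_le_pow_of_le_one (norm_nonneg q) hq.le (Nat.le_mul_of_pos_left j hm)
    have h3 := (norm_add_le ((q ^ 2) ^ j) ((q ^ 3) ^ j)).trans
      (add_le_add (h2 2 (by norm_num)) (h2 3 (by norm_num)))
    rw [norm_mul, norm_mul, norm_pow (-1 : ℂ), norm_neg, norm_one, one_pow, one_mul, two_mul]
    exact (mul_le_mul h1 h3 (norm_nonneg _) zero_le_one).trans_eq (one_mul _)

lemma summable_norm_pow_sq_mul_qPochRecip {q : ℂ} (hq : ‖q‖ < 1) :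
    Summable fun k : ℕ => ‖q ^ (k ^ 2) * qPochRecip q k‖ := by
  obtain ⟨C, hC⟩ := exists_norm_qPochRecip_le hq
  refine Summable.of_nonneg_of_le (fun _ => norm_nonneg _) (fun k => ?_)
    ((summable_geometric_of_lt_one (norm_nonneg q) hq).mul_right C)
  rw [norm_mul, norm_pow]
  exact mul_le_mul (pow_le_pow_of_le_one (norm_nonneg q) hq.le (Nat.le_self_pow two_ne_zero k))
    (hC k) (norm_nonneg _) (by positivity)

lemma tsum_pow_sq_mul_qPochRecip {q : ℂ} (hq : ‖q‖ < 1) (hq0 : q ≠ 0) :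
    ∑' k : ℕ, q ^ (k ^ 2) * qPochRecip q k =
      1 / (qPochInf q (q ^ 5) * qPochInf (q ^ 4) (q ^ 5)) := by
  obtain ⟨C, hC⟩ := exists_norm_qPochRecip_le hq
  have hpow : ∀ m : ℕ, m ≠ 0 → ‖q ^ m‖ < 1 := fun m hm => by
    rw [norm_pow]
    exact pow_lt_one₀ (norm_nonneg q) hq hm
  have hq5 := hpow 5 (by norm_num)
  have hsum := summable_norm_thetaCoeff_five hq
  have h1 := tendsto_sum_range_succ_mul (E := fun n k => qPochRecip q (n - k))
    (summable_norm_pow_sq_mul_qPochRecip hq) (fun n k => hC (n - k))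
    fun k => (tendsto_qPochRecip hq).comp (tendsto_sub_atTop_nat k)
  simp_rw [sum_qPochRecip_eq_sum_thetaCoeff hq hq0, pow_sq_mul_thetaCoeff] at h1
  have h2 := tendsto_nhds_unique h1 (tendsto_sum_mul_qPochRecip_mul hq hsum)
  rw [tsum_thetaCoeff hq5 (pow_ne_zero 5 hq0) (by ring) hsum] at h2
  have hne := qPochInf_ne_zero hq hq
  have hdis := qPochInf_five_dissection hq hq5
  have ha := qPochInf_ne_zero hq5 hq
  have hb := qPochInf_ne_zero hq5 (hpow 4 (by norm_num))
  rw [eq_div_iff (mul_ne_zero ha hb)]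
  apply mul_right_cancel₀ hne
  field_simp at h2
  linear_combination (qPochInf q (q ^ 5) * qPochInf (q ^ 4) (q ^ 5)) * h2 - hdis

/-- The first Rogers–Ramanujan identity: for `‖q‖ < 1`,
`∑_{k=0}^∞ q^{k²} / (q;q)_k = 1 / ((q;q⁵)_∞ (q⁴;q⁵)_∞)`. -/
theorem rogers_ramanujan_first (q : ℂ) (hq : ‖q‖ < 1) :
    HasSum (fun k : ℕ => q ^ (k ^ 2) / qPoch q q k)
      (1 / (qPochInf q (q ^ 5) * qPochInf (q ^ 4) (q ^ 5))) := by
  rcases eq_or_ne q 0 with rfl | hq0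
  · convert hasSum_single (f := fun k : ℕ => (0 : ℂ) ^ (k ^ 2) / qPoch 0 0 k) 0 ?_ using 1
    · simp [qPoch, qPochInf]
    · intro k hk
      simp [hk]
  · rw [← tsum_pow_sq_mul_qPochRecip hq hq0]
    simpa only [div_eq_mul_inv, qPochRecip] using
      (summable_norm_pow_sq_mul_qPochRecip hq).of_norm.hasSum
end
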